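/- Let $M_n$ be the $n\times n$ real symmetric matrix with entries $M_n(j,k) = \frac{1}{\sqrt{2\pi}}\,\frac{\Gamma(j+k-3/2)}{\sqrt{\Gamma(2j-1)\Gamma(2k-1)}}$ for $1\le j,k\le n$, and for $0\le k\le n$ let $c_{n,k}$ denote the coefficient of $z^k$ in the polynomial $z \mapsto \det(I_n + (z-1) M_n)$. Then for every fixed positive integer $k$ and every $\epsilon > 0$ there exists $N_\epsilon$ such that for all $n > N_\epsilon$ with $n \ge k$, $c_{n,k} \ge \det(I_n - M_n)\,\left(\frac{\sqrt{n/\pi}\,(1-\epsilon) - k + 1}{n - k + 1}\right)^{k}$. -/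

import Mathlib

/-- The `n × n` real symmetric matrix with entries
`M_n(j,k) = Γ(j+k-3/2) / (√(2π) √(Γ(2j-1) Γ(2k-1)))` for `1 ≤ j,k ≤ n`. -/
noncomputable def ginibreM (n : ℕ) : Matrix (Fin n) (Fin n) ℝ :=
  Matrix.of fun j k =>
    (1 / Real.sqrt (2 * Real.pi)) *
      Real.Gamma (((j : ℕ) + 1 : ℝ) + ((k : ℕ) + 1 : ℝ) - 3 / 2) /
        Real.sqrt (Real.Gamma (2 * ((j : ℕ) + 1 : ℝ) - 1) *
          Real.Gamma (2 * ((k : ℕ) + 1 : ℝ) - 1))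

/-- The coefficient of `z^k` in the polynomial `z ↦ det(I_n + (z-1) M_n)`. -/
noncomputable def ginibreCoeff (n k : ℕ) : ℝ :=
  (Matrix.det ((1 : Matrix (Fin n) (Fin n) (Polynomial ℝ)) +
    (Polynomial.X - 1 : Polynomial ℝ) • (ginibreM n).map Polynomial.C)).coeff k

open Finset Polynomial in
/-- If `μ i ∈ [0,1]`, the `k`-th coefficient of `∏ (1 - μ i + μ i X)` is at least
`∏ (1 - μ i)` times `max (∑ μ i - k) 0 ^ k / k!`. -/
theorem coeff_prod_lower_bound {ι : Type*} [DecidableEq ι] (s : Finset ι) (μ : ι → ℝ)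
    (h0 : ∀ i, 0 ≤ μ i) (h1 : ∀ i, μ i ≤ 1) (k : ℕ) :
    (∏ i ∈ s, (1 - μ i)) * (max (∑ i ∈ s, μ i - k) 0 ^ k / k.factorial) ≤
      (∏ i ∈ s, (C (1 - μ i) + C (μ i) * X)).coeff k := by
  have step (x y : ℝ) (hy : 0 ≤ y) (hxy : y ≤ x) (m : ℕ) :
      x ^ (m + 1) ≤ y ^ (m + 1) + (m + 1) * (x - y) * x ^ m := by
    induction m with
    | zero => simp
    | succ m ih =>
      have h := mul_le_mul_of_nonneg_left ih (hy.trans hxy)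
      have h2 : (x - y) * y ^ (m + 1) ≤ (x - y) * x ^ (m + 1) :=
        mul_le_mul_of_nonneg_left (pow_le_pow_left₀ hy hxy _) (by linarith)
      push_cast
      calc x ^ (m + 1 + 1) = x * x ^ (m + 1) := by ring
        _ ≤ _ := h
        _ = y ^ (m + 1 + 1) + (x - y) * y ^ (m + 1) + (m + 1) * (x - y) * x ^ (m + 1) := by ring
        _ ≤ _ := by linarith
  induction s using Finset.induction_on generalizing k with
  | empty => cases k with
    | zero => simp
    | succ k =>
      have : max (-((k : ℝ) + 1)) 0 = 0 := max_eq_right (by linarith [k.cast_nonneg (α := ℝ)])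
      rw [sum_empty, zero_sub]
      push_cast
      rw [this]
      simp [coeff_one]
  | insert a s ha ih =>
    rw [prod_insert ha, prod_insert ha, sum_insert ha]
    have hP : 0 ≤ ∏ i ∈ s, (1 - μ i) := prod_nonneg fun i _ => by linarith [h1 i]
    have ha0 := h0 a
    have ha1 := h1 a
    cases k with
    | zero =>
      have h := ih 0
      simp only [pow_zero, Nat.factorial_zero, Nat.cast_one, div_one, mul_one] at h ⊢
      rw [add_mul, coeff_add, coeff_C_mul, mul_assoc (C (μ a)), coeff_C_mul, coeff_X_mul_zero]
      simpa using mul_le_mul_of_nonneg_left h (sub_nonneg.2 ha1)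
    | succ k =>
      have hk := ih k
      have hk1 := ih (k + 1)
      rw [add_mul, coeff_add, coeff_C_mul, mul_assoc (C (μ a)), coeff_C_mul, coeff_X_mul]
      set S := ∑ i ∈ s, μ i
      set P := ∏ i ∈ s, (1 - μ i)
      push_cast at hk hk1 ⊢
      have hxy : max (S - (k + 1)) 0 ≤ max (μ a + S - (k + 1)) 0 :=
        max_le_max (by linarith) le_rfl
      have hd : max (μ a + S - (k + 1)) 0 - max (S - (k + 1)) 0 ≤ μ a := by
        rw [sub_le_iff_le_add]
        exact max_le (by linarith [le_max_left (S - (k + 1 : ℝ)) 0])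
          (by linarith [le_max_right (S - (k + 1 : ℝ)) 0])
      have hxz : max (μ a + S - (k + 1)) 0 ≤ max (S - k) 0 := max_le_max (by linarith) le_rfl
      have hx0 : 0 ≤ max (μ a + S - (k + 1)) 0 := le_max_right _ _
      have key : max (μ a + S - (k + 1)) 0 ^ (k + 1) / ((k + 1).factorial : ℝ) ≤
          max (S - (k + 1)) 0 ^ (k + 1) / ((k + 1).factorial : ℝ) +
            μ a * (max (S - k) 0 ^ k / (k.factorial : ℝ)) := by
        have h := step _ _ (le_max_right _ _) hxy k
        have h2 : (max (μ a + S - (k + 1)) 0 - max (S - (k + 1)) 0) *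
            max (μ a + S - (k + 1)) 0 ^ k ≤ μ a * max (S - k) 0 ^ k :=
          mul_le_mul hd (pow_le_pow_left₀ hx0 hxz k) (by positivity) ha0
        have hf : (0 : ℝ) < k.factorial := by positivity
        rw [Nat.factorial_succ]
        push_cast
        rw [div_add' _ _ _ (by positivity), div_le_div_iff_of_pos_right (by positivity)]
        calc _ ≤ _ := h
          _ ≤ max (S - (k + 1)) 0 ^ (k + 1) + (k + 1) * (μ a * max (S - k) 0 ^ k) := by
            rw [mul_assoc]; gcongr
          _ = _ := by field_simp
      set A := max (S - (k + 1 : ℝ)) 0 ^ (k + 1) / ((k + 1).factorial : ℝ)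
      set B := max (S - (k : ℝ)) 0 ^ k / (k.factorial : ℝ)
      have hB : 0 ≤ B := by positivity
      calc _ ≤ (1 - μ a) * P * (A + μ a * B) := by
            gcongr
        _ = (1 - μ a) * (P * A) + μ a * (P * B) - μ a * μ a * (P * B) := by ring
        _ ≤ (1 - μ a) * (P * A) + μ a * (P * B) := by
            have : 0 ≤ μ a * μ a * (P * B) := by positivity
            linarith
        _ ≤ _ := by gcongr

open Polynomial in
/-- The determinant of `1 + (X - 1) A` factors over the eigenvalues of a Hermitian `A`. -/
theorem det_one_add_X_sub_one_smul {n : Type*} [Fintype n] [DecidableEq n] {A : Matrix n n ℝ}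
    (hA : A.IsHermitian) :
    Matrix.det (1 + (X - 1 : ℝ[X]) • A.map C) =
      ∏ i, (C (1 - hA.eigenvalues i) + C (hA.eigenvalues i) * X) := by
  set U : Matrix n n ℝ := hA.eigenvectorUnitary.1
  set V : Matrix n n ℝ := star U
  have hA' : A = U * Matrix.diagonal hA.eigenvalues * V := by
    have h := hA.spectral_theorem
    rw [Unitary.conjStarAlgAut_apply] at h
    exact h
  have hUV : U * V = 1 := Unitary.mul_star_self_of_mem hA.eigenvectorUnitary.2
  have hUV' : U.map C * V.map C = (1 : Matrix n n ℝ[X]) := by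
    rw [← Matrix.map_mul, hUV]; simp
  have h1 : 1 + (X - 1 : ℝ[X]) • A.map C = U.map C *
      (1 + (X - 1 : ℝ[X]) • (Matrix.diagonal hA.eigenvalues).map C) * V.map C := by
    rw [mul_add, add_mul, mul_one, hUV', Matrix.mul_smul, Matrix.smul_mul, ← Matrix.map_mul,
      ← Matrix.map_mul, ← hA']
  have h2 : (1 + (X - 1 : ℝ[X]) • (Matrix.diagonal hA.eigenvalues).map C) =
      Matrix.diagonal fun i => C (1 - hA.eigenvalues i) + C (hA.eigenvalues i) * X := by
    ext1 i j
    by_cases h : i = j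
    · subst h; simp; ring
    · simp [h]
  rw [h1, Matrix.det_mul_right_comm, hUV', one_mul, h2, Matrix.det_diagonal]

/-- Schur test: a symmetric entrywise nonnegative matrix with a positive subinvariant vector has
quadratic form at most the identity. -/
theorem dotProduct_mulVec_le_of_subinvariant {n : Type*} [Fintype n] {A : Matrix n n ℝ}
    (hA : A.IsSymm) (hpos : ∀ i j, 0 ≤ A i j) (w : n → ℝ) (hw : ∀ i, 0 < w i)
    (hAw : ∀ i, ∑ j, A i j * w j ≤ w i) (v : n → ℝ) :
    dotProduct v (A.mulVec v) ≤ dotProduct v v := by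
  have hterm (i j : n) : v i * (A i j * v j) ≤
      (A i j * (v i ^ 2 * w j / w i) + A j i * (v j ^ 2 * w i / w j)) / 2 := by
    rw [hA.apply i j]
    have hi := hw i
    have hj := hw j
    have : v i ^ 2 * w j / w i + v j ^ 2 * w i / w j - 2 * (v i * v j) =
        (v i * w j - v j * w i) ^ 2 / (w i * w j) := by field_simp; ring
    have h2 : 0 ≤ (v i * w j - v j * w i) ^ 2 / (w i * w j) := by positivity
    nlinarith [mul_nonneg (hpos i j) (this ▸ h2)]
  have hrow : ∑ i, ∑ j, A i j * (v i ^ 2 * w j / w i) ≤ dotProduct v v := by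
    refine Finset.sum_le_sum fun i _ => ?_
    have hi := hw i
    calc ∑ j, A i j * (v i ^ 2 * w j / w i) = v i ^ 2 / w i * ∑ j, A i j * w j := by
          rw [Finset.mul_sum]; exact Finset.sum_congr rfl fun j _ => by ring
      _ ≤ v i ^ 2 / w i * w i := by gcongr; exact hAw i
      _ = v i * v i := by field_simp
  calc dotProduct v (A.mulVec v) = ∑ i, ∑ j, v i * (A i j * v j) := by
        simp [dotProduct, Matrix.mulVec, Finset.mul_sum]
    _ ≤ ∑ i, ∑ j, (A i j * (v i ^ 2 * w j / w i) + A j i * (v j ^ 2 * w i / w j)) / 2 :=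
        Finset.sum_le_sum fun i _ => Finset.sum_le_sum fun j _ => hterm i j
    _ = (∑ i, ∑ j, A i j * (v i ^ 2 * w j / w i) +
          ∑ i, ∑ j, A j i * (v j ^ 2 * w i / w j)) / 2 := by
        simp only [← Finset.sum_add_distrib, Finset.sum_div]
    _ ≤ _ := by
        rw [Finset.sum_comm (f := fun i j => A j i * (v j ^ 2 * w i / w j))]
        linarith

open MeasureTheory Set in
/-- Partial sums of the binomial series `∑ Γ(a+k) / (2^k k!) = 2^a Γ(a)` are at most its value. -/
theorem sum_Gamma_div_two_pow_mul_factorial_le {a : ℝ} (ha : 0 < a) (n : ℕ) :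
    ∑ k ∈ Finset.range n, Real.Gamma (a + k) / (2 ^ k * k.factorial) ≤ 2 ^ a * Real.Gamma a := by
  have hG (k : ℕ) : 0 < a + (k : ℝ) := by positivity
  have hint : ∫ t : ℝ in Ioi 0, t ^ (a - 1) * Real.exp (-((1 / 2) * t)) = 2 ^ a * Real.Gamma a := by
    rw [Real.integral_rpow_mul_exp_neg_mul_Ioi ha (by norm_num)]
    norm_num
  have hne : (2 : ℝ) ^ a * Real.Gamma a ≠ 0 := by
    have := Real.Gamma_pos_of_pos ha
    positivity
  have hintegrable : IntegrableOn (fun t : ℝ => t ^ (a - 1) * Real.exp (-((1 / 2) * t))) (Ioi 0) := by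
    by_contra h
    exact hne (hint ▸ integral_undef h)
  have hI (k : ℕ) := (Real.GammaIntegral_convergent (hG k)).div_const (2 ^ k * (k.factorial : ℝ))
  rw [← hint]
  calc _ = ∑ k ∈ Finset.range n, ∫ t in Ioi (0 : ℝ),
          Real.exp (-t) * t ^ (a + k - 1) / (2 ^ k * (k.factorial : ℝ)) :=
        Finset.sum_congr rfl fun k _ => by rw [integral_div, Real.Gamma_eq_integral (hG k)]
    _ = ∫ t in Ioi (0 : ℝ), ∑ k ∈ Finset.range n,
          Real.exp (-t) * t ^ (a + k - 1) / (2 ^ k * (k.factorial : ℝ)) :=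
        (integral_finsetSum _ fun k _ => hI k).symm
    _ ≤ _ := by
        refine setIntegral_mono_on (integrable_finsetSum _ fun k _ => hI k) hintegrable
          measurableSet_Ioi fun t (ht : 0 < t) => ?_
        have hsum := Real.sum_le_exp_of_nonneg (x := t / 2) (by positivity) n
        calc _ = Real.exp (-t) * t ^ (a - 1) *
              ∑ k ∈ Finset.range n, (t / 2) ^ k / (k.factorial : ℝ) := by
              rw [Finset.mul_sum]
              refine Finset.sum_congr rfl fun k _ => ?_
              rw [div_pow, show a + k - 1 = (a - 1) + (k : ℝ) by ring, Real.rpow_add ht, Real.rpow_natCast]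
              field_simp
          _ ≤ Real.exp (-t) * t ^ (a - 1) * Real.exp (t / 2) := by gcongr
          _ = _ := by
              rw [show -((1 / 2) * t) = -t + t / 2 by ring, Real.exp_add]
              ring

/-- Closed form of `Γ` at half-integers in terms of factorials. -/
theorem four_pow_mul_factorial_mul_Gamma (j : ℕ) :
    4 ^ j * j.factorial * Real.Gamma (j + 1 / 2) = Real.sqrt Real.pi * (2 * j).factorial := by
  induction j with
  | zero => simp [-one_div, Real.Gamma_one_half_eq]
  | succ j ih =>
    push_cast
    rw [show (j : ℝ) + 1 + 1 / 2 = (j + 1 / 2) + 1 by ring, Real.Gamma_add_one (by positivity),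
      show 2 * (j + 1) = 2 * j + 1 + 1 by ring, Nat.factorial_succ, Nat.factorial_succ,
      Nat.factorial_succ]
    push_cast
    linear_combination (2 * (2 * (j : ℝ) + 1) * (j + 1)) * ih

theorem ginibreM_apply (n : ℕ) (j k : Fin n) :
    ginibreM n j k = Real.Gamma ((j : ℕ) + (k : ℕ) + 1 / 2) /
      (Real.sqrt (2 * Real.pi) * (Real.sqrt (2 * (j : ℕ)).factorial *
        Real.sqrt (2 * (k : ℕ)).factorial)) := by
  have hf (m : ℕ) : Real.Gamma (2 * ((m : ℝ) + 1) - 1) = (2 * m).factorial := by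
    rw [← Real.Gamma_nat_eq_factorial]
    push_cast
    ring_nf
  rw [ginibreM, Matrix.of_apply, hf, hf,
    Real.sqrt_mul (x := (2 * (j : ℕ)).factorial) (by positivity),
    show ((j : ℕ) + 1 : ℝ) + ((k : ℕ) + 1) - 3 / 2 = (j : ℕ) + (k : ℕ) + 1 / 2 by ring]
  field_simp

theorem ginibreM_isSymm (n : ℕ) : (ginibreM n).IsSymm := by
  ext j k
  rw [Matrix.transpose_apply, ginibreM_apply, ginibreM_apply, add_comm ((k : ℕ) : ℝ),
    mul_comm (Real.sqrt (2 * (k : ℕ)).factorial)]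

theorem ginibreM_nonneg (n : ℕ) (j k : Fin n) : 0 ≤ ginibreM n j k := by
  have := Real.Gamma_pos_of_pos (s := (j : ℕ) + (k : ℕ) + 1 / 2) (by positivity)
  rw [ginibreM_apply]
  positivity

/-- The vector `√(2j)! / (2^j j!)` is subinvariant for `ginibreM`. -/
theorem ginibreM_subinvariant (n : ℕ) (j : Fin n) :
    ∑ k : Fin n, ginibreM n j k *
      (Real.sqrt (2 * (k : ℕ)).factorial / (2 ^ (k : ℕ) * (k : ℕ).factorial)) ≤
      Real.sqrt (2 * (j : ℕ)).factorial / (2 ^ (j : ℕ) * (j : ℕ).factorial) := by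
  have hsum := sum_Gamma_div_two_pow_mul_factorial_le (a := (j : ℕ) + 1 / 2) (by positivity) n
  have hG := four_pow_mul_factorial_mul_Gamma j
  calc _ = (∑ k ∈ Finset.range n, Real.Gamma ((j : ℕ) + 1 / 2 + k) / (2 ^ k * k.factorial)) /
        (Real.sqrt (2 * Real.pi) * Real.sqrt (2 * (j : ℕ)).factorial) := by
        rw [← Fin.sum_univ_eq_sum_range
          (fun k => Real.Gamma ((j : ℕ) + 1 / 2 + k) / (2 ^ k * k.factorial)), Finset.sum_div]
        refine Finset.sum_congr rfl fun k _ => ?_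
        rw [ginibreM_apply, add_right_comm]
        field_simp
    _ ≤ 2 ^ (((j : ℕ) : ℝ) + 1 / 2) * Real.Gamma ((j : ℕ) + 1 / 2) /
        (Real.sqrt (2 * Real.pi) * Real.sqrt (2 * (j : ℕ)).factorial) := by gcongr
    _ = _ := by
        have h4 : (4 : ℝ) ^ (j : ℕ) = 2 ^ (j : ℕ) * 2 ^ (j : ℕ) := by
          rw [← mul_pow]; norm_num
        rw [h4] at hG
        rw [Real.rpow_add (by norm_num), Real.rpow_natCast, ← Real.sqrt_eq_rpow,
          Real.sqrt_mul (by norm_num), div_eq_div_iff (by positivity) (by positivity)]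
        linear_combination Real.sqrt 2 * hG - Real.sqrt 2 * Real.sqrt Real.pi *
          Real.sq_sqrt (show (0 : ℝ) ≤ (2 * (j : ℕ)).factorial by positivity)

open MeasureTheory Set in
/-- `ginibreM` is a Gram matrix, hence its quadratic form is nonnegative. -/
theorem dotProduct_ginibreM_mulVec_nonneg (n : ℕ) (v : Fin n → ℝ) :
    0 ≤ dotProduct v ((ginibreM n).mulVec v) := by
  set c : Fin n → ℝ := fun j => v j / Real.sqrt (2 * (j : ℕ)).factorial with hc
  have hpos (j k : Fin n) : (0 : ℝ) < (j : ℕ) + (k : ℕ) + 1 / 2 := by positivity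
  have hI (j k : Fin n) := (Real.GammaIntegral_convergent (hpos j k)).const_mul (c j * c k)
  have h : Real.sqrt (2 * Real.pi) * dotProduct v ((ginibreM n).mulVec v) =
      ∫ t in Ioi (0 : ℝ), ∑ j, ∑ k, c j * c k *
        (Real.exp (-t) * t ^ (((j : ℕ) : ℝ) + (k : ℕ) + 1 / 2 - 1)) := by
    rw [integral_finsetSum _ fun j _ => integrable_finsetSum _ fun k _ => hI j k]
    simp only [dotProduct, Matrix.mulVec, Finset.mul_sum]
    refine Finset.sum_congr rfl fun j _ => ?_
    rw [integral_finsetSum _ fun k _ => hI j k]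
    refine Finset.sum_congr rfl fun k _ => ?_
    rw [integral_const_mul, ← Real.Gamma_eq_integral (hpos j k), ginibreM_apply]
    simp only [hc]
    field_simp
  have hnn : 0 ≤ Real.sqrt (2 * Real.pi) * dotProduct v ((ginibreM n).mulVec v) := by
    rw [h]
    refine setIntegral_nonneg measurableSet_Ioi fun t (ht : 0 < t) => ?_
    have : ∑ j, ∑ k, c j * c k * (Real.exp (-t) * t ^ (((j : ℕ) : ℝ) + (k : ℕ) + 1 / 2 - 1)) =
        Real.exp (-t) * t ^ (-(1 / 2) : ℝ) * (∑ j, c j * t ^ (j : ℕ)) ^ 2 := by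
      rw [sq, Finset.sum_mul_sum, Finset.mul_sum]
      refine Finset.sum_congr rfl fun j _ => ?_
      rw [Finset.mul_sum]
      refine Finset.sum_congr rfl fun k _ => ?_
      rw [show ((j : ℕ) : ℝ) + (k : ℕ) + 1 / 2 - 1 = (j : ℕ) + (k : ℕ) + -(1 / 2) by ring,
        Real.rpow_add ht, Real.rpow_add ht, Real.rpow_natCast, Real.rpow_natCast]
      ring
    rw [this]
    positivity
  exact nonneg_of_mul_nonneg_right hnn (by positivity)

theorem ginibreM_isHermitian (n : ℕ) : (ginibreM n).IsHermitian := by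
  rw [Matrix.IsHermitian, Matrix.conjTranspose_eq_transpose_of_trivial]
  exact ginibreM_isSymm n

theorem ginibreM_eigenvalues_nonneg (n : ℕ) (i : Fin n) :
    0 ≤ (ginibreM_isHermitian n).eigenvalues i := by
  rw [Matrix.IsHermitian.eigenvalues_eq]
  exact dotProduct_ginibreM_mulVec_nonneg n _

theorem ginibreM_eigenvalues_le_one (n : ℕ) (i : Fin n) :
    (ginibreM_isHermitian n).eigenvalues i ≤ 1 := by
  set e := (ginibreM_isHermitian n).eigenvectorBasis i
  have he : dotProduct e.ofLp e.ofLp = 1 := by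
    have h := real_inner_self_eq_norm_sq e
    rw [(ginibreM_isHermitian n).eigenvectorBasis.orthonormal.1 i,
      EuclideanSpace.inner_eq_star_dotProduct] at h
    simpa using h
  rw [Matrix.IsHermitian.eigenvalues_eq, ← he]
  exact dotProduct_mulVec_le_of_subinvariant (ginibreM_isSymm n) (ginibreM_nonneg n)
    (fun j => Real.sqrt (2 * (j : ℕ)).factorial / (2 ^ (j : ℕ) * (j : ℕ).factorial))
    (fun j => by positivity) (ginibreM_subinvariant n) _

theorem factorial_two_mul_le (j : ℕ) :
    ((2 * j).factorial : ℝ) ≤ 2 * (j + 1) * Real.Gamma (j + j + 1 / 2) := by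
  rcases Nat.eq_zero_or_pos j with rfl | hj
  · have h : (1 : ℝ) ≤ Real.sqrt Real.pi := Real.one_le_sqrt.2 (by linarith [Real.pi_gt_three])
    simp [-one_div, Real.Gamma_one_half_eq]
    linarith
  · have hj1 : (1 : ℝ) ≤ j := by exact_mod_cast hj
    have hG : 0 < Real.Gamma (j + j + 1 / 2 : ℝ) := Real.Gamma_pos_of_pos (by positivity)
    calc ((2 * j).factorial : ℝ) = Real.Gamma (j + j + 1) := by
          rw [← Real.Gamma_nat_eq_factorial]; push_cast; ring_nf
      _ ≤ Real.Gamma (j + j + 1 / 2 + 1) :=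
          Real.Gamma_strictMonoOn_Ici.monotoneOn (Set.mem_Ici.2 (by linarith))
            (Set.mem_Ici.2 (by linarith)) (by linarith)
      _ = (j + j + 1 / 2) * Real.Gamma (j + j + 1 / 2) := Real.Gamma_add_one (by positivity)
      _ ≤ _ := by gcongr; linarith

open Filter in
theorem tendsto_trace_ginibreM : Tendsto (fun n => (ginibreM n).trace) atTop atTop := by
  refine tendsto_atTop_mono (fun n => ?_)
    (Real.tendsto_sum_range_one_div_nat_succ_atTop.const_mul_atTop
      (show 0 < 1 / (2 * Real.sqrt (2 * Real.pi)) by positivity))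
  rw [Finset.mul_sum, Matrix.trace, ← Fin.sum_univ_eq_sum_range
    (fun j => 1 / (2 * Real.sqrt (2 * Real.pi)) * (1 / ((j : ℝ) + 1)))]
  refine Finset.sum_le_sum fun j _ => ?_
  rw [Matrix.diag_apply, ginibreM_apply, Real.mul_self_sqrt (by positivity),
    div_mul_div_comm, div_le_div_iff₀ (by positivity) (by positivity)]
  have h := mul_le_mul_of_nonneg_left (factorial_two_mul_le j)
    (Real.sqrt_nonneg (2 * Real.pi))
  linarith

/-- The base of the lower bound has absolute value at most `1` once `n` is large. -/
theorem exists_abs_sqrt_mul_sub_div_le_one (k : ℕ) (ε : ℝ) :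
    ∃ N : ℕ, ∀ n : ℕ, N < n →
      |(Real.sqrt ((n : ℝ) / Real.pi) * (1 - ε) - (k : ℝ) + 1) / ((n : ℝ) - (k : ℝ) + 1)| ≤ 1 := by
  obtain ⟨N, hN⟩ := exists_nat_ge ((|1 - ε| + 2 * k + 1) ^ 2)
  refine ⟨N, fun n hn => ?_⟩
  have hn' : (|1 - ε| + 2 * k + 1) ^ 2 ≤ (n : ℝ) := hN.trans (by exact_mod_cast hn.le)
  have hs : |1 - ε| + 2 * k + 1 ≤ Real.sqrt n := Real.le_sqrt_of_sq_le hn'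
  have hsq : Real.sqrt n * Real.sqrt n = n := Real.mul_self_sqrt (by positivity)
  have hle : Real.sqrt ((n : ℝ) / Real.pi) ≤ Real.sqrt n :=
    Real.sqrt_le_sqrt (div_le_self (by positivity) (by linarith [Real.pi_gt_three]))
  have hA := abs_nonneg (1 - ε)
  have hk : (0 : ℝ) ≤ k := by positivity
  have h1 : |Real.sqrt ((n : ℝ) / Real.pi) * (1 - ε)| ≤ Real.sqrt n * |1 - ε| := by
    rw [abs_mul, abs_of_nonneg (Real.sqrt_nonneg _)]
    gcongr
  have h2 : Real.sqrt n * |1 - ε| + 2 * k + 1 ≤ n := by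
    nlinarith [mul_le_mul_of_nonneg_left hs (Real.sqrt_nonneg n)]
  have h3 := abs_le.1 h1
  have hs0 := mul_nonneg (Real.sqrt_nonneg n) hA
  have hden : 0 < (n : ℝ) - k + 1 := by linarith
  rw [abs_div, abs_of_pos hden, div_le_one hden, abs_le]
  constructor <;> linarith [h3.1, h3.2]

theorem stmt19 (k : ℕ) (hk : 0 < k) :
    ∀ ε : ℝ, 0 < ε → ∃ Nε : ℕ, ∀ n : ℕ, Nε < n → k ≤ n →
      ginibreCoeff n k ≥
        Matrix.det (1 - ginibreM n) *
          ((Real.sqrt ((n : ℝ) / Real.pi) * (1 - ε) - (k : ℝ) + 1) /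
            ((n : ℝ) - (k : ℝ) + 1)) ^ k := by
  intro ε _
  obtain ⟨N₁, hN₁⟩ := exists_abs_sqrt_mul_sub_div_le_one k ε
  obtain ⟨N₂, hN₂⟩ := Filter.eventually_atTop.1
    (tendsto_trace_ginibreM.eventually_ge_atTop ((k : ℝ) + k.factorial))
  refine ⟨max N₁ N₂, fun n hn _ => ?_⟩
  have hM := ginibreM_isHermitian n
  have h0 := ginibreM_eigenvalues_nonneg n
  have h1 := ginibreM_eigenvalues_le_one n
  have hbase : _ ^ k ≤ (1 : ℝ) := (le_abs_self _).trans <| (abs_pow _ k).trans_le <|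
    pow_le_one₀ (abs_nonneg _) (hN₁ n ((le_max_left _ _).trans_lt hn))
  have htr := hN₂ n ((le_max_right _ _).trans hn.le)
  rw [hM.trace_eq_sum_eigenvalues] at htr
  simp only [RCLike.ofReal_real_eq_id, id_eq] at htr
  have hfac : (1 : ℝ) ≤ k.factorial := by exact_mod_cast k.factorial_pos
  have hphi : 1 ≤ max (∑ i, hM.eigenvalues i - k) 0 ^ k / (k.factorial : ℝ) := by
    rw [one_le_div (by positivity)]
    have h : (k.factorial : ℝ) ≤ max (∑ i, hM.eigenvalues i - k) 0 :=
      le_max_of_le_left (by linarith)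
    exact h.trans (le_self_pow₀ (hfac.trans h) hk.ne')
  have hpoly := det_one_add_X_sub_one_smul hM
  have hdet : Matrix.det (1 - ginibreM n) = ∏ i, (1 - hM.eigenvalues i) := by
    have h := congrArg (Polynomial.evalRingHom (0 : ℝ)) hpoly
    rw [RingHom.map_det, map_prod] at h
    convert h using 2
    · ext i j
      by_cases hij : i = j
      · subst hij; simp [sub_eq_add_neg]
      · simp [hij]
    · simp
  have hdet0 : 0 ≤ Matrix.det (1 - ginibreM n) :=
    hdet ▸ Finset.prod_nonneg fun i _ => sub_nonneg.2 (h1 i)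
  have hcoeff := coeff_prod_lower_bound Finset.univ hM.eigenvalues h0 h1 k
  rw [← hpoly, ← hdet] at hcoeff
  exact (mul_le_mul_of_nonneg_left (hbase.trans hphi) hdet0).trans hcoeff
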